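/- Let n, k, s be positive integers with 1 ≤ s ≤ k+1 and 2k < n. Let S_k denote the (k+1)×(k+1) symmetric tridiagonal matrix with zero diagonal and off-diagonal entries a_i = √((i+1)(n−i)) for i = 0,…,k−1. Then (2(s−1)/s)·√((k−s+2)(n−k+s−1)) ≤ λmax(S_k) ≤ 2√(k(n−k+1)). -/

import Mathlib

/-- Symmetric tridiagonal (k+1)×(k+1) matrix with diagonal `d 0, …, d k` and
off-diagonal `o 0, …, o (k-1)`. -/
noncomputable def Tridiag (k : ℕ) (d o : ℕ → ℝ) : Matrix (Fin (k + 1)) (Fin (k + 1)) ℝ :=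
  Matrix.of fun i j =>
    if (i : ℕ) = (j : ℕ) then d i
    else if (i : ℕ) + 1 = (j : ℕ) then o i
    else if (j : ℕ) + 1 = (i : ℕ) then o j
    else 0

/-- The largest eigenvalue of a real square matrix. -/
noncomputable def maxEig {m : ℕ} (M : Matrix (Fin m) (Fin m) ℝ) : ℝ :=
  sSup {μ : ℝ | Module.End.HasEigenvalue (Matrix.toLin' M) μ}

theorem Tridiag_isHermitian (k : ℕ) (d o : ℕ → ℝ) : (Tridiag k d o).IsHermitian := by
  ext i j
  simp only [Tridiag, Matrix.conjTranspose_apply, Matrix.of_apply, star_trivial]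
  split_ifs <;> first | omega | simp_all

/-- The quadratic form of a symmetric matrix is bounded by any upper bound of its eigenvalues. -/
theorem Matrix.IsHermitian.dotProduct_mulVec_le {m : ℕ} {A : Matrix (Fin m) (Fin m) ℝ}
    (hA : A.IsHermitian) {M : ℝ}
    (hM : ∀ μ, Module.End.HasEigenvalue (Matrix.toLin' A) μ → μ ≤ M) (x : Fin m → ℝ) :
    x ⬝ᵥ A.mulVec x ≤ M * (x ⬝ᵥ x) := by
  have hB : (M • (1 : Matrix (Fin m) (Fin m) ℝ) - A).IsHermitian := by
    refine Matrix.IsHermitian.sub ?_ hA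
    simp [Matrix.IsHermitian]
  have hpos : (M • (1 : Matrix (Fin m) (Fin m) ℝ) - A).PosSemidef := by
    rw [hB.posSemidef_iff_eigenvalues_nonneg]
    intro i
    have h1 := hB.mulVec_eigenvectorBasis i
    have hne : (hB.eigenvectorBasis i).ofLp ≠ 0 := by
      intro h
      apply hB.eigenvectorBasis.orthonormal.ne_zero i
      ext j
      exact congrFun h j
    have h2 : Module.End.HasEigenvalue (Matrix.toLin' A) (M - hB.eigenvalues i) := by
      refine Module.End.hasEigenvalue_of_hasEigenvector
        (x := (hB.eigenvectorBasis i).ofLp) ⟨?_, hne⟩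
      rw [Module.End.mem_eigenspace_iff, Matrix.toLin'_apply, sub_smul, ← h1,
        Matrix.sub_mulVec, Matrix.smul_mulVec, Matrix.one_mulVec]
      abel
    have := hM _ h2
    simp only [Pi.zero_apply]
    linarith
  have h := hpos.dotProduct_mulVec_nonneg x
  rw [Matrix.sub_mulVec, Matrix.smul_mulVec, Matrix.one_mulVec, dotProduct_sub,
    dotProduct_smul, smul_eq_mul, star_trivial] at h
  linarith

/-- Gershgorin bound for tridiagonal matrices with zero diagonal. -/
theorem Tridiag_eigenvalue_le {k : ℕ} {o : ℕ → ℝ} {c : ℝ} (hc : 0 ≤ c)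
    (ho : ∀ i < k, |o i| ≤ c) {μ : ℝ}
    (hμ : Module.End.HasEigenvalue (Matrix.toLin' (Tridiag k (fun _ => 0) o)) μ) :
    μ ≤ 2 * c := by
  obtain ⟨i, hi⟩ := eigenvalue_mem_ball hμ
  have hle : ∑ j ∈ Finset.univ.erase i, ‖Tridiag k (fun _ => 0) o i j‖ ≤ 2 * c := by
    have hind : ∀ p : Fin (k + 1) → Prop, ∀ [DecidablePred p],
        (∀ a b, p a → p b → a = b) → ∑ j, (if p j then c else 0) ≤ c := by
      intro p _ hp
      rw [← Finset.sum_filter, Finset.sum_const, nsmul_eq_mul]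
      have : (Finset.univ.filter p).card ≤ 1 :=
        Finset.card_le_one.2 fun a ha b hb => hp a b (by simpa using ha) (by simpa using hb)
      exact mul_le_of_le_one_left hc (by exact_mod_cast this)
    calc _ ≤ ∑ j : Fin (k + 1), ‖Tridiag k (fun _ => 0) o i j‖ :=
          Finset.sum_le_sum_of_subset_of_nonneg (Finset.subset_univ _)
            fun _ _ _ => norm_nonneg _
      _ ≤ ∑ j : Fin (k + 1), ((if (i : ℕ) + 1 = j then c else 0)
            + if (j : ℕ) + 1 = i then c else 0) := by
          refine Finset.sum_le_sum fun j _ => ?_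
          simp only [Tridiag, Matrix.of_apply, Real.norm_eq_abs]
          split_ifs <;> first
            | omega
            | (simp only [abs_zero]; linarith)
            | (simp only [add_zero, zero_add]; exact ho _ (by omega))
      _ ≤ c + c := by
          rw [Finset.sum_add_distrib]
          exact add_le_add (hind _ fun a b _ _ => by omega) (hind _ fun a b _ _ => by omega)
      _ = 2 * c := by ring
  rw [mem_closedBall_iff_norm, Real.norm_eq_abs] at hi
  have := (le_abs_self _).trans (hi.trans hle)
  simpa [Tridiag] using this

/-- Rayleigh bound from the indicator vector of the last `s` coordinates. -/
theorem Tridiag_le_of_eigenvalue_le {k s : ℕ} (hs1 : 1 ≤ s) (hs2 : s ≤ k + 1) {o : ℕ → ℝ}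
    {c M : ℝ} (ho : ∀ i < k, k + 1 ≤ i + s → c ≤ o i)
    (hM : ∀ μ, Module.End.HasEigenvalue (Matrix.toLin' (Tridiag k (fun _ => 0) o)) μ → μ ≤ M) :
    2 * ((s : ℝ) - 1) * c ≤ M * s := by
  let x : Fin (k + 1) → ℝ := fun i => if k + 1 ≤ (i : ℕ) + s then 1 else 0
  let g : ℕ → ℕ → ℝ := fun i j => if i + 1 = j then (if k + 1 ≤ i + s then c else 0) else 0
  have hxx : x ⬝ᵥ x = s := by
    simp only [x, dotProduct, mul_ite, mul_one, mul_zero]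
    rw [Fin.sum_univ_eq_sum_range (fun i => if k + 1 ≤ i + s then
      (if k + 1 ≤ i + s then (1 : ℝ) else 0) else 0) (k + 1)]
    have : (Finset.range (k + 1)).filter (fun i => k + 1 ≤ i + s)
        = Finset.Ico (k + 1 - s) (k + 1) := by
      ext i; simp only [Finset.mem_filter, Finset.mem_range, Finset.mem_Ico]; omega
    rw [← Finset.sum_filter, Finset.sum_congr rfl (g := fun _ => (1 : ℝ)), this]
    · simp only [Finset.sum_const, Nat.card_Ico, nsmul_eq_mul, mul_one]
      congr 1; omega
    · intro i hi
      exact if_pos (Finset.mem_filter.1 hi).2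
  have hg : ∑ i : Fin (k + 1), ∑ j : Fin (k + 1), g i j = ((s : ℝ) - 1) * c := by
    have hrow : ∀ i : Fin (k + 1), ∑ j : Fin (k + 1), g i j
        = if k + 1 ≤ (i : ℕ) + s ∧ (i : ℕ) < k then c else 0 := by
      intro i
      rw [Fin.sum_univ_eq_sum_range (fun j => g i j) (k + 1)]
      simp only [g, Finset.sum_ite_eq, Finset.mem_range]
      split_ifs <;> first | rfl | omega
    simp only [hrow]
    rw [Fin.sum_univ_eq_sum_range (fun i => if k + 1 ≤ i + s ∧ i < k then c else 0) (k + 1),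
      ← Finset.sum_filter]
    have : (Finset.range (k + 1)).filter (fun i => k + 1 ≤ i + s ∧ i < k)
        = Finset.Ico (k + 1 - s) k := by
      ext i; simp only [Finset.mem_filter, Finset.mem_range, Finset.mem_Ico]; omega
    rw [this, Finset.sum_const, Nat.card_Ico, nsmul_eq_mul,
      show k - (k + 1 - s) = s - 1 by omega, Nat.cast_sub hs1, Nat.cast_one]
  have hray := (Tridiag_isHermitian k (fun _ => 0) o).dotProduct_mulVec_le hM x
  rw [hxx] at hray
  refine le_trans ?_ hray
  calc 2 * ((s : ℝ) - 1) * c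
      = ∑ i : Fin (k + 1), ∑ j : Fin (k + 1), (g i j + g j i) := by
        simp only [Finset.sum_add_distrib]
        rw [hg, Finset.sum_comm, hg]; ring
    _ ≤ ∑ i : Fin (k + 1), ∑ j : Fin (k + 1), x i * (Tridiag k (fun _ => 0) o i j * x j) := by
        refine Finset.sum_le_sum fun i _ => Finset.sum_le_sum fun j _ => ?_
        simp only [g, x, Tridiag, Matrix.of_apply]
        split_ifs <;> first
          | omega
          | (simp only [mul_zero, zero_mul, add_zero, le_refl]; done)
          | (simp only [one_mul, mul_one, zero_add, add_zero]; exact ho _ (by omega) (by omega))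
    _ = x ⬝ᵥ (Tridiag k (fun _ => 0) o).mulVec x := by
        simp only [dotProduct, Matrix.mulVec, Finset.mul_sum]

/-- The squared Krawtchouk recurrence coefficients increase on the first half. -/
theorem krawtchouk_coeff_mono {n i j : ℕ} (hij : i ≤ j) (hj : 2 * j < n) :
    ((i : ℝ) + 1) * ((n : ℝ) - i) ≤ ((j : ℝ) + 1) * ((n : ℝ) - j) := by
  have h1 : (i : ℝ) ≤ j := by exact_mod_cast hij
  have h2 : 2 * (j : ℝ) + 1 ≤ n := by exact_mod_cast hj
  nlinarith [mul_nonneg (sub_nonneg.2 h1) (show (0 : ℝ) ≤ n - 1 - i - j by linarith)]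

/-- Bounds on the largest eigenvalue of the Krawtchouk tridiagonal matrix `S_k`. -/
theorem krawtchouk_maxEig_bounds (n k s : ℕ) (hk : 1 ≤ k) (hs1 : 1 ≤ s) (hs2 : s ≤ k + 1)
    (hkn : 2 * k < n) :
    (2 * ((s : ℝ) - 1) / (s : ℝ)) * Real.sqrt (((k : ℝ) - s + 2) * ((n : ℝ) - k + s - 1))
        ≤ maxEig (Tridiag k (fun _ => 0)
            (fun i => Real.sqrt (((i : ℝ) + 1) * ((n : ℝ) - i))))
      ∧ maxEig (Tridiag k (fun _ => 0)
            (fun i => Real.sqrt (((i : ℝ) + 1) * ((n : ℝ) - i))))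
        ≤ 2 * Real.sqrt ((k : ℝ) * ((n : ℝ) - k + 1)) := by
  set o : ℕ → ℝ := fun i => Real.sqrt (((i : ℝ) + 1) * ((n : ℝ) - i))
  have hup : ∀ μ, Module.End.HasEigenvalue (Matrix.toLin' (Tridiag k (fun _ => 0) o)) μ →
      μ ≤ 2 * Real.sqrt ((k : ℝ) * ((n : ℝ) - k + 1)) := by
    intro μ hμ
    refine Tridiag_eigenvalue_le (Real.sqrt_nonneg _) (fun i hi => ?_) hμ
    rw [abs_of_nonneg (Real.sqrt_nonneg _)]
    apply Real.sqrt_le_sqrt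
    refine (krawtchouk_coeff_mono (n := n) (Nat.le_sub_one_of_lt hi) (by omega)).trans_eq ?_
    rw [Nat.cast_sub hk]
    push_cast
    ring
  refine ⟨?_, Real.sSup_le hup (by positivity)⟩
  have hs : (0 : ℝ) < s := by exact_mod_cast hs1
  rw [div_mul_eq_mul_div, div_le_iff₀ hs]
  refine Tridiag_le_of_eigenvalue_le hs1 hs2 (fun i hi his => ?_)
    fun μ hμ => le_csSup ⟨_, hup⟩ hμ
  apply Real.sqrt_le_sqrt
  refine le_of_eq_of_le ?_
    (krawtchouk_coeff_mono (n := n) (show k + 1 - s ≤ i by omega) (by omega))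
  rw [Nat.cast_sub hs2]
  push_cast
  ring
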